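/- arXiv:2601.05134 — 3 statements merged into one kernel-verified Lean document; each statement's English description precedes it below -/
import Mathlib

section
/- Let γ > 0 and λ > 0 with γλ < 1, let C₀, C₁ > 0 satisfy λC₀/C₁ < 1, let q > 0, ε > 0, σ > 0, and let T ≥ 1 be an integer. Suppose there exist nonnegative reals a₀, …, a_{T−1} such that (i) ∑_{t=0}^{T−1} (1−γλ)^{T−1−t} a_t ≥ 2C₀ (1−γλ)^T + 2γC₁ ∑_{t=0}^{T−1} (1−γλ)^{T−1−t}, and (ii) ∑_{t=0}^{T−1} q a_t² / (2σ²) ≤ ε. Then σ² ≥ γ(2 − γλ) · (2q/ε) · (2 − λC₀/C₁) · C₀ C₁. -/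
open Finset

/-- The reflected geometric sum. -/
lemma one_sub_mul_sum_range_pow_reflect (x : ℝ) (T : ℕ) :
    (1 - x) * ∑ t ∈ Finset.range T, x ^ (T - 1 - t) = 1 - x ^ T := by
  rw [Finset.sum_range_reflect (fun t => x ^ t) T]
  exact mul_neg_geom_sum x T

/-- Any shift sequence meeting the shift budget has energy at least
`4γ(2 - γλ)(2C₁ - λC₀)C₀`, whatever its length. -/
lemma le_sum_sq_of_shift_budget {γ lam C₀ C₁ : ℝ} {T : ℕ} {a : ℕ → ℝ}
    (hγ : 0 < γ) (hlam : 0 < lam) (hγlam : γ * lam < 1)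
    (hC₀ : 0 < C₀) (hC₁ : 0 < C₁) (hT : 1 ≤ T)
    (h : 2 * C₀ * (1 - γ * lam) ^ T
        + 2 * γ * C₁ * ∑ t ∈ Finset.range T, (1 - γ * lam) ^ (T - 1 - t)
        ≤ ∑ t ∈ Finset.range T, (1 - γ * lam) ^ (T - 1 - t) * a t) :
    4 * γ * (2 - γ * lam) * (2 * C₁ - lam * C₀) * C₀ ≤ ∑ t ∈ Finset.range T, a t ^ 2 := by
  have hρ : 0 < 1 - γ * lam := by linarith
  have hS := one_sub_mul_sum_range_pow_reflect (1 - γ * lam) T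
  have hQ := one_sub_mul_sum_range_pow_reflect ((1 - γ * lam) ^ 2) T
  have hS0 : 0 ≤ ∑ t ∈ Finset.range T, (1 - γ * lam) ^ (T - 1 - t) :=
    Finset.sum_nonneg fun t _ => by positivity
  have hQ0 : 0 < ∑ t ∈ Finset.range T, ((1 - γ * lam) ^ 2) ^ (T - 1 - t) :=
    Finset.sum_pos (fun t _ => by positivity) ⟨0, Finset.mem_range.2 hT⟩
  have hCS := Finset.sum_mul_sq_le_sq_mul_sq (Finset.range T)
    (fun t => (1 - γ * lam) ^ (T - 1 - t)) a
  simp only [pow_right_comm _ _ 2] at hCS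
  rw [pow_right_comm] at hQ
  have hr : 0 < (1 - γ * lam) ^ T := by positivity
  generalize (1 - γ * lam) ^ T = r at *
  generalize ∑ t ∈ Finset.range T, (1 - γ * lam) ^ (T - 1 - t) = S at *
  generalize ∑ t ∈ Finset.range T, ((1 - γ * lam) ^ 2) ^ (T - 1 - t) = Q at *
  set P := 2 * C₀ * r + 2 * γ * C₁ * S with hP
  have hP0 : 0 ≤ P := by positivity
  have hPQ : P ^ 2 ≤ Q * ∑ t ∈ Finset.range T, a t ^ 2 :=
    (pow_le_pow_left₀ hP0 h 2).trans hCS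
  have hlamP : lam * P = 2 * (lam * C₀ * r + C₁ * (1 - r)) := by
    rw [hP]; linear_combination 2 * C₁ * hS
  have key : lam ^ 2 * (Q * (4 * γ * (2 - γ * lam) * (2 * C₁ - lam * C₀) * C₀))
      ≤ lam ^ 2 * P ^ 2 := by
    have e : lam ^ 2 * (Q * (4 * γ * (2 - γ * lam) * (2 * C₁ - lam * C₀) * C₀))
        = 4 * (1 - r ^ 2) * (2 * C₁ - lam * C₀) * (lam * C₀) := by
      linear_combination 4 * (2 * C₁ - lam * C₀) * (lam * C₀) * hQ
    rw [e, ← mul_pow, hlamP]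
    nlinarith [sq_nonneg (r * C₁ - (C₁ - lam * C₀))]
  exact le_of_mul_le_mul_left ((le_of_mul_le_mul_left key (by positivity)).trans hPQ) hQ0

/-- Per-step noise lower bound for noisy fine-tuning, regime λC₀/C₁ ∈ (0,1). -/
theorem noise_lower_bound_small_ratio
    (γ lam C₀ C₁ q ε σ : ℝ) (T : ℕ)
    (hγ : 0 < γ) (hlam : 0 < lam) (hγlam : γ * lam < 1)
    (hC₀ : 0 < C₀) (hC₁ : 0 < C₁) (hratio : lam * C₀ / C₁ < 1)
    (hq : 0 < q) (hε : 0 < ε) (hσ : 0 < σ) (hT : 1 ≤ T)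
    (h : ∃ a : ℕ → ℝ, (∀ t, t < T → 0 ≤ a t) ∧
      (2 * C₀ * (1 - γ * lam) ^ T
        + 2 * γ * C₁ * ∑ t ∈ Finset.range T, (1 - γ * lam) ^ (T - 1 - t)
        ≤ ∑ t ∈ Finset.range T, (1 - γ * lam) ^ (T - 1 - t) * a t) ∧
      (∑ t ∈ Finset.range T, q * (a t) ^ 2 / (2 * σ ^ 2) ≤ ε)) :
    σ ^ 2 ≥ γ * (2 - γ * lam) * (2 * q / ε) * (2 - lam * C₀ / C₁) * C₀ * C₁ := by
  obtain ⟨a, -, hshift, hbudget⟩ := h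
  have hA := le_sum_sq_of_shift_budget hγ hlam hγlam hC₀ hC₁ hT hshift
  rw [← Finset.sum_div, ← Finset.mul_sum, div_le_iff₀ (by positivity)] at hbudget
  have e : γ * (2 - γ * lam) * (2 * q / ε) * (2 - lam * C₀ / C₁) * C₀ * C₁
      = q * (4 * γ * (2 - γ * lam) * (2 * C₁ - lam * C₀) * C₀) / (2 * ε) := by
    field_simp
    ring
  rw [ge_iff_le, e, div_le_iff₀ (by positivity)]
  linarith [mul_le_mul_of_nonneg_left hA hq.le]
end

section
/- Let γ > 0 and λ > 0 with γλ < 1, let C₀, C₁ > 0 satisfy λC₀/C₁ ≥ 1, let q > 0, ε > 0, σ > 0, and let T ≥ 1 be an integer. Suppose there exist nonnegative reals a₀, …, a_{T−1} such that (i) ∑_{t=0}^{T−1} (1−γλ)^{T−1−t} a_t ≥ 2C₀ (1−γλ)^T + 2γC₁ ∑_{t=0}^{T−1} (1−γλ)^{T−1−t}, and (ii) ∑_{t=0}^{T−1} q a_t² / (2σ²) ≤ ε. Then σ² > γ(2 − γλ) · (2q/ε) · C₁²/λ. -/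
open Finset

/-- Per-step noise lower bound for noisy fine-tuning, regime λC₀/C₁ ∈ [1,∞). -/
theorem noise_lower_bound_large_ratio
    (γ lam C₀ C₁ q ε σ : ℝ) (T : ℕ)
    (hγ : 0 < γ) (hlam : 0 < lam) (hγlam : γ * lam < 1)
    (hC₀ : 0 < C₀) (hC₁ : 0 < C₁) (hratio : 1 ≤ lam * C₀ / C₁)
    (hq : 0 < q) (hε : 0 < ε) (hσ : 0 < σ) (hT : 1 ≤ T)
    (h : ∃ a : ℕ → ℝ, (∀ t, t < T → 0 ≤ a t) ∧
      (2 * C₀ * (1 - γ * lam) ^ T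
        + 2 * γ * C₁ * ∑ t ∈ Finset.range T, (1 - γ * lam) ^ (T - 1 - t)
        ≤ ∑ t ∈ Finset.range T, (1 - γ * lam) ^ (T - 1 - t) * a t) ∧
      (∑ t ∈ Finset.range T, q * (a t) ^ 2 / (2 * σ ^ 2) ≤ ε)) :
    σ ^ 2 > γ * (2 - γ * lam) * (2 * q / ε) * (C₁ ^ 2 / lam) := by
  obtain ⟨a, -, hshift, hbudget⟩ := h
  set r := 1 - γ * lam with hr
  have hr0 : 0 < r := by linarith
  have hgl : 0 < γ * lam := mul_pos hγ hlam
  have hS1 : (∑ t ∈ Finset.range T, r ^ (T - 1 - t)) * (γ * lam) = 1 - r ^ T := by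
    rw [Finset.sum_range_reflect (fun t => r ^ t) T, ← geom_sum_mul_neg r T]
    congr 1
    rw [hr]
    ring
  have hS2 : (∑ t ∈ Finset.range T, (r ^ (T - 1 - t)) ^ 2) * (γ * lam * (2 - γ * lam)) < 1 := by
    have hgeom := geom_sum_mul_neg (r ^ 2) T
    rw [Finset.sum_range_reflect (fun t => (r ^ t) ^ 2) T]
    simp only [← pow_mul, mul_comm _ 2] at hgeom ⊢
    have hpow : 0 < r ^ (2 * T) := pow_pos hr0 _
    have hfac : γ * lam * (2 - γ * lam) = 1 - r ^ 2 := by rw [hr]; ring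
    rw [hfac]
    linarith
  have hC : C₁ ≤ lam * C₀ := by rwa [le_div_iff₀ hC₁, one_mul] at hratio
  have hlower : 2 * C₁ ≤ lam * ∑ t ∈ Finset.range T, r ^ (T - 1 - t) * a t := by
    have hscaled := mul_le_mul_of_nonneg_left hshift hlam.le
    have hrC := mul_le_mul_of_nonneg_right hC (pow_pos hr0 T).le
    linear_combination hscaled + 2 * hrC - 2 * C₁ * hS1
  have hcs := Finset.sum_mul_sq_le_sq_mul_sq (Finset.range T) (fun t => r ^ (T - 1 - t)) a
  have hA : q * ∑ t ∈ Finset.range T, (a t) ^ 2 ≤ ε * (2 * σ ^ 2) := by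
    rw [← Finset.sum_div, ← Finset.mul_sum, div_le_iff₀ (by positivity)] at hbudget
    exact hbudget
  set S := ∑ t ∈ Finset.range T, r ^ (T - 1 - t) * a t
  set A := ∑ t ∈ Finset.range T, (a t) ^ 2
  set B := ∑ t ∈ Finset.range T, (r ^ (T - 1 - t)) ^ 2
  have hsq : (2 * C₁) ^ 2 ≤ lam ^ 2 * (B * A) := by
    calc (2 * C₁) ^ 2 ≤ (lam * S) ^ 2 := by gcongr
      _ = lam ^ 2 * S ^ 2 := by ring
      _ ≤ lam ^ 2 * (B * A) := by gcongr
  have hA0 : 0 < A := by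
    have hB : 0 ≤ B := Finset.sum_nonneg fun t _ => sq_nonneg _
    by_contra! hneg
    have : lam ^ 2 * (B * A) ≤ 0 :=
      mul_nonpos_of_nonneg_of_nonpos (sq_nonneg _) (mul_nonpos_of_nonneg_of_nonpos hB hneg)
    have : 0 < (2 * C₁) ^ 2 := by positivity
    linarith
  have hd : 0 < 2 - γ * lam := by linarith
  have hkey : 4 * C₁ ^ 2 * (γ * (2 - γ * lam)) * q < lam * (ε * (2 * σ ^ 2)) := by
    calc 4 * C₁ ^ 2 * (γ * (2 - γ * lam)) * q
        = (2 * C₁) ^ 2 * (γ * (2 - γ * lam) * q) := by ring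
      _ ≤ lam ^ 2 * (B * A) * (γ * (2 - γ * lam) * q) := by gcongr
      _ = B * (γ * lam * (2 - γ * lam)) * (lam * (q * A)) := by ring
      _ < 1 * (lam * (q * A)) := by gcongr
      _ ≤ lam * (ε * (2 * σ ^ 2)) := by rw [one_mul]; gcongr
  have hform : γ * (2 - γ * lam) * (2 * q / ε) * (C₁ ^ 2 / lam)
      = 2 * C₁ ^ 2 * (γ * (2 - γ * lam)) * q / (ε * lam) := by
    field_simp
  rw [gt_iff_lt, hform, div_lt_iff₀ (by positivity)]
  linarith
end

section
/- Let γ > 0 and λ > 0 with γλ < 1, let C₀, C₁ > 0 satisfy 0 < λC₀/C₁ < 1, let q > 0, ε > 0, and set σ² to the minimal feasible value σ²_min = γ(2 − γλ) · (2q/ε) · (2 − λC₀/C₁) · C₀C₁. If an integer T ≥ 1 admits nonnegative reals a₀, …, a_{T−1} with ∑_{t=0}^{T−1} (1−γλ)^{T−1−t} a_t ≥ 2C₀ (1−γλ)^T + 2γC₁ ∑_{t=0}^{T−1} (1−γλ)^{T−1−t} and ∑_{t=0}^{T−1} q a_t² / (2σ²_min) ≤ ε, then (1−γλ)^T ≤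 1 − λC₀/C₁; equivalently, T ≥ log(1 − λC₀/C₁) / log(1 − γλ). -/
open Finset

/-- Minimal-noise step count for noisy fine-tuning, regime λC₀/C₁ ∈ (0,1):
at the minimal feasible noise variance, any feasible step count `T` satisfies
`(1-γλ)^T ≤ 1 - λC₀/C₁`, equivalently `T ≥ log(1-λC₀/C₁)/log(1-γλ)`. -/
theorem step_count_at_minimal_noise
    (γ lam C₀ C₁ q ε : ℝ) (T : ℕ)
    (hγ : 0 < γ) (hlam : 0 < lam) (hγlam : γ * lam < 1)
    (hC₀ : 0 < C₀) (hC₁ : 0 < C₁)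
    (hratio_pos : 0 < lam * C₀ / C₁) (hratio : lam * C₀ / C₁ < 1)
    (hq : 0 < q) (hε : 0 < ε) (hT : 1 ≤ T)
    (σ2min : ℝ)
    (hσ2min : σ2min = γ * (2 - γ * lam) * (2 * q / ε) * (2 - lam * C₀ / C₁) * C₀ * C₁)
    (h : ∃ a : ℕ → ℝ, (∀ t, t < T → 0 ≤ a t) ∧
      (2 * C₀ * (1 - γ * lam) ^ T
        + 2 * γ * C₁ * ∑ t ∈ Finset.range T, (1 - γ * lam) ^ (T - 1 - t)
        ≤ ∑ t ∈ Finset.range T, (1 - γ * lam) ^ (T - 1 - t) * a t) ∧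
      (∑ t ∈ Finset.range T, q * (a t) ^ 2 / (2 * σ2min) ≤ ε)) :
    (1 - γ * lam) ^ T ≤ 1 - lam * C₀ / C₁ ∧
      (T : ℝ) ≥ Real.log (1 - lam * C₀ / C₁) / Real.log (1 - γ * lam) := by
  obtain ⟨a, -, hshift, hbudget⟩ := h
  have hr0 : 0 < 1 - γ * lam := by linarith
  have hγl : 0 < γ * lam := mul_pos hγ hlam
  have hr1 : 1 - γ * lam < 1 := by linarith
  have hpow : (1 - γ * lam) ^ T ≤ 1 - lam * C₀ / C₁ := by
    set x := (1 - γ * lam) ^ T with hx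
    set ρ := lam * C₀ / C₁ with hρ
    have hC₀eq : lam * C₀ = ρ * C₁ := by rw [hρ]; field_simp
    have hx0 : 0 < x := pow_pos hr0 T
    have hx1 : x ≤ 1 := pow_le_one₀ hr0.le hr1.le
    have hσ : 0 < σ2min := by
      rw [hσ2min]
      have : 0 < 2 - γ * lam := by linarith
      have : 0 < 2 - ρ := by linarith
      positivity
    have hS : γ * lam * ∑ t ∈ Finset.range T, (1 - γ * lam) ^ (T - 1 - t) = 1 - x := by
      rw [Finset.sum_range_reflect (fun k => (1 - γ * lam) ^ k) T]
      linear_combination mul_neg_geom_sum (1 - γ * lam) T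
    have hQ : γ * lam * (2 - γ * lam) *
        ∑ t ∈ Finset.range T, ((1 - γ * lam) ^ (T - 1 - t)) ^ 2 = 1 - x ^ 2 := by
      have hgeom := mul_neg_geom_sum ((1 - γ * lam) ^ 2) T
      rw [Finset.sum_range_reflect (fun k => ((1 - γ * lam) ^ k) ^ 2) T]
      simp only [← pow_mul, mul_comm _ 2] at hgeom ⊢
      rw [hx, ← pow_mul, mul_comm T 2]
      linear_combination hgeom
    have hA : ∑ t ∈ Finset.range T, a t ^ 2 ≤
        4 * γ * (2 - γ * lam) * (2 - ρ) * C₀ * C₁ := by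
      rw [← Finset.sum_div, ← Finset.mul_sum, div_le_iff₀ (by positivity), hσ2min] at hbudget
      refine le_of_mul_le_mul_left (hbudget.trans_eq ?_) hq
      field_simp
      ring
    have hcs := Finset.sum_mul_sq_le_sq_mul_sq (Finset.range T)
      (fun t => (1 - γ * lam) ^ (T - 1 - t)) a
    have hQ0 : 0 ≤ ∑ t ∈ Finset.range T, ((1 - γ * lam) ^ (T - 1 - t)) ^ 2 :=
      Finset.sum_nonneg fun _ _ => sq_nonneg _
    have hS0 : 0 ≤ ∑ t ∈ Finset.range T, (1 - γ * lam) ^ (T - 1 - t) :=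
      Finset.sum_nonneg fun _ _ => (pow_pos hr0 _).le
    generalize ∑ t ∈ Finset.range T, (1 - γ * lam) ^ (T - 1 - t) = S at *
    generalize ∑ t ∈ Finset.range T, ((1 - γ * lam) ^ (T - 1 - t)) ^ 2 = Q at *
    have hL0 : 0 ≤ 2 * C₀ * x + 2 * γ * C₁ * S := by positivity
    have hmain : (2 * C₀ * x + 2 * γ * C₁ * S) ^ 2 ≤
        Q * (4 * γ * (2 - γ * lam) * (2 - ρ) * C₀ * C₁) :=
      (pow_le_pow_left₀ hL0 hshift 2).trans (hcs.trans (mul_le_mul_of_nonneg_left hA hQ0))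
    have hleft : lam * (2 * C₀ * x + 2 * γ * C₁ * S) = 2 * C₁ * (ρ * x + (1 - x)) := by
      linear_combination 2 * x * hC₀eq + 2 * C₁ * hS
    have hright : lam ^ 2 * (Q * (4 * γ * (2 - γ * lam) * (2 - ρ) * C₀ * C₁)) =
        4 * C₁ ^ 2 * ((1 - x ^ 2) * (ρ * (2 - ρ))) := by
      linear_combination 4 * (2 - ρ) * C₁ * (lam * C₀) * hQ +
        4 * (2 - ρ) * C₁ * (1 - x ^ 2) * hC₀eq
    have hscaled := mul_le_mul_of_nonneg_left hmain (sq_nonneg lam)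
    rw [← mul_pow, hleft, hright] at hscaled
    have hsq : (ρ * x + (1 - x)) ^ 2 ≤ (1 - x ^ 2) * (ρ * (2 - ρ)) :=
      le_of_mul_le_mul_left (by linarith) (show 0 < 4 * C₁ ^ 2 by positivity)
    have hzero : (x - (1 - ρ)) ^ 2 ≤ 0 := by linarith
    have := pow_eq_zero_iff two_ne_zero |>.mp (le_antisymm hzero (sq_nonneg _))
    linarith
  refine ⟨hpow, ?_⟩
  rw [ge_iff_le, div_le_iff_of_neg (Real.log_neg hr0 hr1), ← Real.log_pow]
  exact Real.log_le_log (pow_pos hr0 T) hpow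
end
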